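/- Let D be a 3-regular acyclic finite directed multigraph on m vertices with a unique source and a unique sink. Then there exists an enumeration y_1, y_2, …, y_m of the vertices of D such that every edge of D goes from an earlier vertex to a strictly later vertex in the enumeration, and μ_D(y_1) ≤ μ_D(y_2) ≤ … ≤ μ_D(y_m). -/

import Mathlib

/-- A finite directed multigraph with vertex set `Fin m` and edge set `Fin q`,
given by source and target maps. -/
structure Multigraph (m q : ℕ) where
  src : Fin q → Fin m
  tgt : Fin q → Fin m

namespace Multigraph

variable {m q : ℕ}

/-- `p` is a directed path from `u` to `v`: a nonempty list of edges whose first edge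
starts at `u`, whose last edge ends at `v`, and where consecutive edges are composable. -/
def IsPath (D : Multigraph m q) (u v : Fin m) (p : List (Fin q)) : Prop :=
  (∃ e rest, p = e :: rest ∧ D.src e = u) ∧
  (∃ e rest, p = rest ++ [e] ∧ D.tgt e = v) ∧
  p.Chain' (fun a b => D.tgt a = D.src b)

/-- The number of directed paths from `u` to `v` (paths counted as edge sequences). -/
noncomputable def pathCount (D : Multigraph m q) (u v : Fin m) : ℕ :=
  Nat.card {p : List (Fin q) // D.IsPath u v p}

/-- `D` is acyclic: no vertex has a directed path to itself. -/
def Acyclic (D : Multigraph m q) : Prop :=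
  ∀ v : Fin m, ¬ ∃ p, D.IsPath v v p

/-- In-degree of a vertex. -/
def indeg (D : Multigraph m q) (v : Fin m) : ℕ :=
  (Finset.univ.filter (fun e => D.tgt e = v)).card

/-- Out-degree of a vertex. -/
def outdeg (D : Multigraph m q) (v : Fin m) : ℕ :=
  (Finset.univ.filter (fun e => D.src e = v)).card

/-- `D` is 3-regular: every vertex has total degree 3. -/
def ThreeRegular (D : Multigraph m q) : Prop :=
  ∀ v : Fin m, D.indeg v + D.outdeg v = 3

/-- `s` is the unique source (vertex of in-degree 0) of `D`. -/
def UniqueSource (D : Multigraph m q) (s : Fin m) : Prop :=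
  D.indeg s = 0 ∧ ∀ v : Fin m, D.indeg v = 0 → v = s

/-- `t` is the unique sink (vertex of out-degree 0) of `D`. -/
def UniqueSink (D : Multigraph m q) (t : Fin m) : Prop :=
  D.outdeg t = 0 ∧ ∀ v : Fin m, D.outdeg v = 0 → v = t

/-- `μ_D(v)`: the number of directed paths from `s` to `v`, with `μ_D(s) = 1`. -/
noncomputable def mu (D : Multigraph m q) (s v : Fin m) : ℕ :=
  if v = s then 1 else D.pathCount s v

/-- Two vertices are adjacent (disregarding orientation) via an edge in `S`. -/
def Adj (D : Multigraph m q) (S : Set (Fin q)) (a b : Fin m) : Prop :=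
  ∃ e ∈ S, (D.src e = a ∧ D.tgt e = b) ∨ (D.src e = b ∧ D.tgt e = a)

/-- Weak connectivity using only the edges in `S`: any two distinct vertices are joined
by a finite sequence of edges of `S` traversed in either direction. -/
def WeaklyConnectedOn (D : Multigraph m q) (S : Set (Fin q)) : Prop :=
  ∀ a b : Fin m, a ≠ b → Relation.ReflTransGen (D.Adj S) a b

/-- `D` is weakly connected. -/
def WeaklyConnected (D : Multigraph m q) : Prop :=
  D.WeaklyConnectedOn Set.univ

/-- `D` is `ℓ`-edge connected: it has at least two vertices, and deleting any set of at
most `ℓ - 1` edges leaves a weakly connected multigraph. -/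
def EdgeConnected (D : Multigraph m q) (ℓ : ℕ) : Prop :=
  2 ≤ m ∧ ∀ F : Finset (Fin q), F.card ≤ ℓ - 1 → D.WeaklyConnectedOn {e | e ∉ F}

/-- `p` is a directed Hamiltonian path of `D` starting at `u`: a directed path that
visits every vertex exactly once. -/
def IsHamiltonianPath (D : Multigraph m q) (u : Fin m) (p : List (Fin q)) : Prop :=
  (∃ v, D.IsPath u v p) ∧ (u :: p.map D.tgt).Nodup ∧
    ∀ w : Fin m, w ∈ u :: p.map D.tgt

/-- `D` contains a directed Hamiltonian path. -/
def HasHamiltonianPath (D : Multigraph m q) : Prop :=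
  ∃ u p, D.IsHamiltonianPath u p

/-- `D` is simple: no two distinct edges have the same unordered pair of endpoints. -/
def Simple (D : Multigraph m q) : Prop :=
  ∀ e e' : Fin q, e ≠ e' →
    ¬ ((D.src e = D.src e' ∧ D.tgt e = D.tgt e') ∨
       (D.src e = D.tgt e' ∧ D.tgt e = D.src e'))

/-- `D` together with designated edges `H i` (from vertex `i` to vertex `i+1`, 0-based)
is a Hamiltonian-path digraph: the designated edges are pairwise distinct, form the
Hamiltonian path, and every edge goes from a smaller vertex to a larger one.
(Vertices `0, …, m-1` here represent the vertices `1, …, m`.) -/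
def IsHamPathDigraph (D : Multigraph m q) (H : Fin (m - 1) → Fin q) : Prop :=
  Function.Injective H ∧
  (∀ i : Fin (m - 1), (D.src (H i)).val = i.val ∧ (D.tgt (H i)).val = i.val + 1) ∧
  ∀ e : Fin q, (D.src e).val < (D.tgt e).val

end Multigraph

namespace Multigraph

variable {m q : ℕ} {D : Multigraph m q} {u v : Fin m} {p : List (Fin q)}

theorem isPath_singleton (D : Multigraph m q) (e : Fin q) :
    D.IsPath (D.src e) (D.tgt e) [e] :=
  ⟨⟨e, [], rfl, rfl⟩, ⟨e, [], rfl, rfl⟩, List.isChain_singleton e⟩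

theorem IsPath.append_edge {e : Fin q} (h : D.IsPath u (D.src e) p) :
    D.IsPath u (D.tgt e) (p ++ [e]) := by
  obtain ⟨⟨a, l, rfl, ha⟩, ⟨b, l', hb, hbe⟩, hc⟩ := h
  refine ⟨⟨a, l ++ [e], rfl, ha⟩, ⟨e, a :: l, rfl, rfl⟩, ?_⟩
  refine List.isChain_append.2 ⟨hc, List.isChain_singleton e, ?_⟩
  rw [hb]
  simp [hbe]

/-- The relation given by the edges of `D`. -/
def EdgeRel (D : Multigraph m q) (u v : Fin m) : Prop :=
  ∃ e, D.src e = u ∧ D.tgt e = v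

theorem exists_isPath_of_transGen (h : Relation.TransGen D.EdgeRel u v) :
    ∃ p, D.IsPath u v p := by
  induction h with
  | single h =>
    obtain ⟨e, rfl, rfl⟩ := h
    exact ⟨[e], D.isPath_singleton e⟩
  | tail _ h ih =>
    obtain ⟨e, rfl, rfl⟩ := h
    obtain ⟨p, hp⟩ := ih
    exact ⟨p ++ [e], hp.append_edge⟩

/-- The number of vertices from which `v` can be reached by a directed path. -/
noncomputable def rank (D : Multigraph m q) (v : Fin m) : ℕ :=
  {u | Relation.TransGen D.EdgeRel u v}.ncard

theorem Acyclic.rank_src_lt_rank_tgt (h : D.Acyclic) (e : Fin q) :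
    D.rank (D.src e) < D.rank (D.tgt e) := by
  have he : D.EdgeRel (D.src e) (D.tgt e) := ⟨e, rfl, rfl⟩
  refine Set.ncard_lt_ncard (Set.ssubset_iff_exists.2 ⟨fun _ hu => hu.tail he, ?_⟩)
    (Set.toFinite _)
  exact ⟨D.src e, .single he, fun hc => h _ (exists_isPath_of_transGen hc)⟩

theorem Acyclic.nodup_of_isPath (h : D.Acyclic) (hp : D.IsPath u v p) : p.Nodup := by
  have hc : (p.map fun e => D.rank (D.src e)).IsChain (· < ·) := by
    rw [List.isChain_map]
    exact List.IsChain.imp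
      (fun a _ hab => (h.rank_src_lt_rank_tgt a).trans_eq (congrArg _ hab)) hp.2.2
  exact List.Nodup.of_map _ ((List.isChain_iff_pairwise.1 hc).imp ne_of_lt)

theorem Acyclic.finite_isPath (h : D.Acyclic) (u v : Fin m) :
    Finite {p : List (Fin q) // D.IsPath u v p} :=
  Finite.of_injective
    (fun p => (⟨p.1, h.nodup_of_isPath p.2⟩ : {l : List (Fin q) // l.Nodup}))
    fun _ _ hpq => Subtype.ext (Subtype.mk.inj hpq)

theorem Acyclic.pathCount_src_le_pathCount_tgt (h : D.Acyclic) (u : Fin m) (e : Fin q) :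
    D.pathCount u (D.src e) ≤ D.pathCount u (D.tgt e) := by
  have := h.finite_isPath u (D.tgt e)
  refine Nat.card_le_card_of_injective (fun p => ⟨p.1 ++ [e], p.2.append_edge⟩) ?_
  intro p p' hpp
  exact Subtype.ext (List.append_cancel_right (congrArg Subtype.val hpp))

theorem Acyclic.pathCount_src_tgt_pos (h : D.Acyclic) (e : Fin q) :
    0 < D.pathCount (D.src e) (D.tgt e) := by
  have := h.finite_isPath (D.src e) (D.tgt e)
  have : Nonempty {p // D.IsPath (D.src e) (D.tgt e) p} := ⟨⟨[e], D.isPath_singleton e⟩⟩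
  exact Nat.card_pos

theorem tgt_ne_of_indeg_eq_zero (hu : D.indeg u = 0) (e : Fin q) : D.tgt e ≠ u := by
  rw [indeg, Finset.card_eq_zero, Finset.filter_eq_empty_iff] at hu
  exact hu (Finset.mem_univ e)

theorem Acyclic.mu_src_le_mu_tgt (h : D.Acyclic) (hu : D.indeg u = 0) (e : Fin q) :
    D.mu u (D.src e) ≤ D.mu u (D.tgt e) := by
  rw [mu, mu, if_neg (tgt_ne_of_indeg_eq_zero hu e)]
  split_ifs with hsrc
  · exact hsrc ▸ h.pathCount_src_tgt_pos e
  · exact h.pathCount_src_le_pathCount_tgt u e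

end Multigraph

/-- Every 3-regular acyclic finite directed multigraph with a unique source
and unique sink has an enumeration of its vertices compatible with the edge orientations
on which `μ_D` is weakly increasing. -/
theorem exists_mu_monotone_enumeration (m q : ℕ) (D : Multigraph m q) (s t : Fin m)
    (hreg : D.ThreeRegular) (hacy : D.Acyclic)
    (hs : D.UniqueSource s) (ht : D.UniqueSink t) :
    ∃ y : Fin m ≃ Fin m,
      (∀ e : Fin q, y.symm (D.src e) < y.symm (D.tgt e)) ∧
      ∀ i j : Fin m, i ≤ j → D.mu s (y i) ≤ D.mu s (y j) := by
  let key : Fin m → ℕ ×ₗ ℕ := fun v => toLex (D.mu s v, D.rank v)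
  have hmono : Monotone (key ∘ Tuple.sort key) := Tuple.monotone_sort key
  refine ⟨Tuple.sort key, fun e => ?_, fun i j hij => ?_⟩
  · have hlt : key (D.src e) < key (D.tgt e) :=
      Prod.Lex.toLex_lt_toLex'.2
        ⟨hacy.mu_src_le_mu_tgt hs.1 e, fun _ => hacy.rank_src_lt_rank_tgt e⟩
    refine hmono.reflect_lt ?_
    simpa using hlt
  · exact (Prod.Lex.toLex_le_toLex'.1 (hmono hij)).1
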